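/- (Example 4, Full Revelation) Let X = {a, b, c} with a, b, c distinct, and let λ, λ_a, λ_b, λ_c ∈ [0,1] satisfy 1 − λ_b > λ, λ > λ_a, and λ > λ_c. Let π be the choice rule with π(a|{a,b,c}) = λ, π(b|{a,b,c}) = 1−λ, π(c|{a,b,c}) = 0, π(a|{a,b}) = 1−λ_b, π(b|{a,b}) = λ_b, π(a|{a,c}) = λ_a, π(c|{a,c}) = 1−λ_a, π(b|{b,c}) = 1−λ_c, π(c|{b,c}) = λ_c, and π(x|{x}) = 1 for each x. Then π has a RAM representation, and in every RAM representation (≻, μ) of π it holds that a ≻ b and b ≻ c. -/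

import Mathlib

open Finset
open scoped Classical

variable {α : Type*} [Fintype α] [DecidableEq α]

/-- A choice rule: for every choice problem (nonempty finite set) `S`,
`π S` is a probability distribution supported on `S`. -/
def IsChoiceRule (π : Finset α → α → ℝ) : Prop :=
  ∀ S : Finset α, S.Nonempty →
    (∀ a ∈ S, 0 ≤ π S a) ∧ (∀ a, a ∉ S → π S a = 0) ∧ (∑ a ∈ S, π S a) = 1

/-- An attention rule: for every choice problem `S`, `μ S` is a probability
distribution over the nonempty subsets of `S`.  `μ S T` is the probability of
paying attention to the consideration set `T` when the choice problem is `S`. -/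
def IsAttentionRule (μ : Finset α → Finset α → ℝ) : Prop :=
  ∀ S : Finset α, S.Nonempty →
    (∀ T : Finset α, T ⊆ S → T.Nonempty → 0 ≤ μ S T) ∧
    (∀ T : Finset α, ¬(T ⊆ S ∧ T.Nonempty) → μ S T = 0) ∧
    (∑ T ∈ S.powerset, μ S T) = 1

/-- Assumption 1 (Monotonic attention): `μ(T|S) ≤ μ(T|S−a)` for `a ∈ S − T`. -/
def MonotonicAttention (μ : Finset α → Finset α → ℝ) : Prop :=
  ∀ S T : Finset α, S.Nonempty → T ⊆ S → T.Nonempty →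
    ∀ a ∈ S, a ∉ T → μ S T ≤ μ (S.erase a) T

/-- A preference: a strict linear order (asymmetric, transitive, complete). -/
structure IsPref (r : α → α → Prop) : Prop where
  asymm : ∀ a b, r a b → ¬ r b a
  trans : ∀ a b c, r a b → r b c → r a c
  total : ∀ a b, a ≠ b → r a b ∨ r b a

/-- `a` is the `r`-maximal element of `T`. -/
def IsBest (r : α → α → Prop) (a : α) (T : Finset α) : Prop :=
  a ∈ T ∧ ∀ b ∈ T, b ≠ a → r a b

/-- `(r, μ)` represents `π` (without the monotonicity requirement on `μ`):
`π(a|S) = Σ_{T ⊆ S} 1(a is r-best in T) μ(T|S)`. -/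
noncomputable def Represents (π : Finset α → α → ℝ) (r : α → α → Prop)
    (μ : Finset α → Finset α → ℝ) : Prop :=
  IsChoiceRule π ∧ IsPref r ∧ IsAttentionRule μ ∧
  ∀ S : Finset α, S.Nonempty → ∀ a ∈ S,
    π S a = ∑ T ∈ S.powerset, if IsBest r a T then μ S T else 0

/-- `(r, μ)` is a RAM representation of `π`: a representation with `μ` monotonic. -/
def IsRAM (π : Finset α → α → ℝ) (r : α → α → Prop)
    (μ : Finset α → Finset α → ℝ) : Prop :=
  Represents π r μ ∧ MonotonicAttention μ

/-- The revealed-preference relation `P`: `a P b` iff `a ≠ b` and there is a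
choice problem `S` containing `a` and `b` with `π(a|S) > π(a|S−b)`. -/
def Prel (π : Finset α → α → ℝ) (a b : α) : Prop :=
  a ≠ b ∧ ∃ S : Finset α, a ∈ S ∧ b ∈ S ∧ π S a > π (S.erase b) a

/-- Lower contour set of `a` with respect to the preference `r`. -/
noncomputable def lowerContour (r : α → α → Prop) (a : α) : Finset α :=
  Finset.univ.filter fun b => b = a ∨ r a b

/-- An attention rule is triangular w.r.t. `r` if it puts weight only on
(intersections of `S` with) lower contour sets. -/
def Triangular (r : α → α → Prop) (μ : Finset α → Finset α → ℝ) : Prop :=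
  ∀ S T : Finset α, S.Nonempty → 0 < μ S T → ∃ a ∈ S, T = lowerContour r a ∩ S

/-- A (deterministic) attention filter. -/
def IsAttentionFilter (Γ : Finset α → Finset α) : Prop :=
  ∀ S : Finset α, S.Nonempty →
    Γ S ⊆ S ∧ (Γ S).Nonempty ∧
    ∀ a ∈ S, a ∉ Γ S → (S.erase a).Nonempty → Γ (S.erase a) = Γ S

/-- An attention filter is triangular w.r.t. `r` if each `Γ(S)` is the
intersection of `S` with a lower contour set of some element of `S`. -/
def TriangularFilter (r : α → α → Prop) (Γ : Finset α → Finset α) : Prop :=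
  ∀ S : Finset α, S.Nonempty → ∃ a ∈ S, Γ S = lowerContour r a ∩ S

/-- Assumption 3 (φ-attentive at binaries). -/
def AttentiveAtBinaries (φ : ℝ) (μ : Finset α → Finset α → ℝ) : Prop :=
  ∀ a b : α, a ≠ b →
    μ {a, b} {a, b} ≥ (1 - φ) / φ * max (μ {a, b} {a}) (μ {a, b} {b})

/-- A deterministic attention rule. -/
def Deterministic (μ : Finset α → Finset α → ℝ) : Prop :=
  ∀ S T : Finset α, S.Nonempty → μ S T = 0 ∨ μ S T = 1

/-- If removing `b` strictly lowers the choice probability of `a`, then `a` is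
preferred to `b` in every RAM representation. -/
theorem IsRAM.rel_of_prel {β : Type*} [DecidableEq β] {π : Finset β → β → ℝ}
    {r : β → β → Prop} {μ : Finset β → Finset β → ℝ} (h : IsRAM π r μ) {a b : β} (hP : Prel π a b) :
    r a b := by
  obtain ⟨⟨-, hr, hμ, hrep⟩, hmono⟩ := h
  obtain ⟨hab, S, haS, hbS, hlt⟩ := hP
  refine (hr.total a b hab).resolve_right fun hba => hlt.not_ge ?_
  have haS' : a ∈ S.erase b := mem_erase.2 ⟨hab, haS⟩
  rw [hrep S ⟨a, haS⟩ a haS, hrep (S.erase b) ⟨a, haS'⟩ a haS']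
  have hsub : (S.erase b).powerset ⊆ S.powerset := powerset_mono.2 (erase_subset b S)
  rw [← sum_subset hsub]
  · refine sum_le_sum fun T hT => ?_
    rw [mem_powerset] at hT
    split_ifs with hbest
    · exact hmono S T ⟨a, haS⟩ (hT.trans (erase_subset b S)) ⟨a, hbest.1⟩ b hbS
        fun hbT => notMem_erase b S (hT hbT)
    · exact le_rfl
  · intro T hT hT'
    refine if_neg fun hbest => hT' ?_
    rw [mem_powerset] at hT ⊢
    refine subset_erase.2 ⟨hT, fun hbT => ?_⟩
    exact hr.asymm _ _ hba (hbest.2 b hbT hab.symm)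

/-- The triangular attention rule that, in the problem `S`, considers the part of
`S` weakly below `x` with probability `π S x`. -/
noncomputable def triangularAttention (π : Finset α → α → ℝ) (r : α → α → Prop)
    (S T : Finset α) : ℝ :=
  ∑ x ∈ S, if T = lowerContour r x ∩ S then π S x else 0

theorem mem_lowerContour_inter {r : α → α → Prop} {x y : α} {S : Finset α} :
    y ∈ lowerContour r x ∩ S ↔ (y = x ∨ r x y) ∧ y ∈ S := by
  simp [lowerContour]

theorem IsPref.isBest_lowerContour_inter_iff {r : α → α → Prop} (hr : IsPref r) {a x : α}
    {S : Finset α} (hx : x ∈ S) : IsBest r a (lowerContour r x ∩ S) ↔ a = x := by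
  constructor
  · rintro ⟨ha, hbest⟩
    by_contra hne
    have hxa := hbest x (mem_lowerContour_inter.2 ⟨Or.inl rfl, hx⟩) (Ne.symm hne)
    exact hr.asymm _ _ hxa ((mem_lowerContour_inter.1 ha).1.resolve_left hne)
  · rintro rfl
    exact ⟨mem_lowerContour_inter.2 ⟨Or.inl rfl, hx⟩, fun b hb hne =>
      (mem_lowerContour_inter.1 hb).1.resolve_left hne⟩

theorem IsChoiceRule.isAttentionRule_triangularAttention {π : Finset α → α → ℝ}
    (hπ : IsChoiceRule π) (r : α → α → Prop) :
    IsAttentionRule (triangularAttention π r) := by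
  intro S hS
  obtain ⟨h0, -, h1⟩ := hπ S hS
  refine ⟨fun T _ _ => sum_nonneg fun x hx => ?_, fun T hT => sum_eq_zero fun x hx => ?_, ?_⟩
  · split_ifs
    exacts [h0 x hx, le_rfl]
  · refine if_neg ?_
    rintro rfl
    exact hT ⟨inter_subset_right, x, mem_lowerContour_inter.2 ⟨Or.inl rfl, hx⟩⟩
  · unfold triangularAttention
    rw [sum_comm, ← h1]
    refine sum_congr rfl fun x _ => ?_
    rw [sum_ite_eq', if_pos (mem_powerset.2 inter_subset_right)]

theorem IsChoiceRule.represents_triangularAttention {π : Finset α → α → ℝ}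
    (hπ : IsChoiceRule π) {r : α → α → Prop} (hr : IsPref r) :
    Represents π r (triangularAttention π r) := by
  refine ⟨hπ, hr, hπ.isAttentionRule_triangularAttention r, fun S _ a ha => ?_⟩
  have key : ∀ T, (if IsBest r a T then triangularAttention π r S T else 0) =
      ∑ x ∈ S, if T = lowerContour r x ∩ S then (if a = x then π S x else 0) else 0 := by
    intro T
    have hdist : (if IsBest r a T then triangularAttention π r S T else 0) =
        ∑ x ∈ S, if IsBest r a T then (if T = lowerContour r x ∩ S then π S x else 0)
          else 0 := by
      split_ifs <;> simp [triangularAttention]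
    rw [hdist]
    refine sum_congr rfl fun x hx => ?_
    by_cases hT : T = lowerContour r x ∩ S
    · subst hT
      simp [hr.isBest_lowerContour_inter_iff hx]
    · simp [hT]
  rw [sum_congr rfl fun T _ => key T, sum_comm]
  have inner : ∀ x ∈ S, (∑ T ∈ S.powerset,
      if T = lowerContour r x ∩ S then (if a = x then π S x else 0) else 0) =
      if a = x then π S x else 0 := fun x _ => by
    rw [sum_ite_eq', if_pos (mem_powerset.2 inter_subset_right)]
  rw [sum_congr rfl inner, sum_ite_eq, if_pos ha]

/-- The triangular attention rule gives a RAM representation as soon as removing an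
alternative preferred to `x` never lowers the choice probability of `x`. -/
theorem IsChoiceRule.isRAM_triangularAttention {π : Finset α → α → ℝ}
    (hπ : IsChoiceRule π) {r : α → α → Prop} (hr : IsPref r)
    (h : ∀ S : Finset α, ∀ x ∈ S, ∀ z ∈ S, r z x → π S x ≤ π (S.erase z) x) :
    IsRAM π r (triangularAttention π r) := by
  refine ⟨hπ.represents_triangularAttention hr, fun S T _ _ _ z hz hzT => ?_⟩
  unfold triangularAttention
  rw [← sum_subset (erase_subset z S)]
  · refine sum_le_sum fun x hx => ?_
    have hxS := mem_of_mem_erase hx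
    by_cases hT : T = lowerContour r x ∩ S
    · have hnot : ¬(z = x ∨ r x z) := fun hzx =>
        hzT (hT ▸ mem_lowerContour_inter.2 ⟨hzx, hz⟩)
      have hT' : T = lowerContour r x ∩ S.erase z := by
        rw [inter_erase, ← hT, erase_eq_of_notMem hzT]
      rw [if_pos hT, if_pos hT']
      exact h S x hxS z hz
        ((hr.total z x fun e => hnot (Or.inl e)).resolve_right fun e => hnot (Or.inr e))
    · rw [if_neg hT]
      split_ifs
      exacts [(hπ _ ⟨x, hx⟩).1 x hx, le_rfl]
  · intro x hx hx'
    obtain rfl : x = z := by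
      by_contra hne
      exact hx' (mem_erase.2 ⟨hne, hx⟩)
    refine if_neg ?_
    rintro rfl
    exact hzT (mem_lowerContour_inter.2 ⟨Or.inl rfl, hx⟩)

theorem IsChoiceRule.le_one {β : Type*} {π : Finset β → β → ℝ} (hπ : IsChoiceRule π)
    {S : Finset β} {x : β} (hx : x ∈ S) : π S x ≤ 1 := by
  obtain ⟨h0, -, h1⟩ := hπ S ⟨x, hx⟩
  exact h1 ▸ single_le_sum h0 hx

/-- Every injective utility function induces a preference. -/
theorem isPref_of_injective {β : Type*} {f : β → ℕ} (hf : Function.Injective f) :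
    IsPref fun x y => f y < f x where
  asymm _ _ := fun h => h.not_gt
  trans _ _ _ := fun h h' => h'.trans h
  total _ _ hne := (lt_or_gt_of_ne (hf.ne hne)).symm

/-- Example 4, Full Revelation: With `X = {a, b, c}` and
`1 − λ_b > λ > λ_a, λ_c`, the choice rule described below has a RAM
representation, and every RAM representation `(≻, μ)` satisfies `a ≻ b` and
`b ≻ c`. -/
theorem stmt15 (a b c : α) (hab : a ≠ b) (hac : a ≠ c) (hbc : b ≠ c)
    (huniv : ∀ x : α, x = a ∨ x = b ∨ x = c)
    (l la lb lc : ℝ)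
    (hl : 0 ≤ l ∧ l ≤ 1) (hla : 0 ≤ la ∧ la ≤ 1)
    (hlb : 0 ≤ lb ∧ lb ≤ 1) (hlc : 0 ≤ lc ∧ lc ≤ 1)
    (h1 : 1 - lb > l) (h2 : l > la) (h3 : l > lc)
    (π : Finset α → α → ℝ) (hπ : IsChoiceRule π)
    (p1 : π {a, b, c} a = l) (p2 : π {a, b, c} b = 1 - l) (p3 : π {a, b, c} c = 0)
    (p4 : π {a, b} a = 1 - lb) (p5 : π {a, b} b = lb)
    (p6 : π {a, c} a = la) (p7 : π {a, c} c = 1 - la)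
    (p8 : π {b, c} b = 1 - lc) (p9 : π {b, c} c = lc)
    (p10 : ∀ x : α, π {x} x = 1) :
    (∃ (r : α → α → Prop) (μ : Finset α → Finset α → ℝ), IsRAM π r μ) ∧
      ∀ (r : α → α → Prop) (μ : Finset α → Finset α → ℝ),
        IsRAM π r μ → r a b ∧ r b c := by
  have ea : ({a, b, c} : Finset α).erase a = {b, c} := by grind
  have eb : ({a, b, c} : Finset α).erase b = {a, c} := by grind
  have ec : ({a, b, c} : Finset α).erase c = {a, b} := by grind
  refine ⟨?_, fun r μ h => ⟨h.rel_of_prel ⟨hab, {a, b, c}, by simp, by simp, ?_⟩,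
    h.rel_of_prel ⟨hbc, {a, b, c}, by simp, by simp, ?_⟩⟩⟩
  · have hf : Function.Injective fun x => if x = a then 2 else if x = b then 1 else 0 := by
      intro x y
      rcases huniv x with rfl | rfl | rfl <;> rcases huniv y with rfl | rfl | rfl <;> grind
    refine ⟨_, _, hπ.isRAM_triangularAttention (isPref_of_injective hf) ?_⟩
    intro S x hx z hz hzx
    have hne : x ≠ z := by grind
    by_cases hS : S.erase z = {x}
    · rw [hS, p10]
      exact hπ.le_one hx
    · have hS' : S = {a, b, c} := by
        obtain ⟨w, hw, hwx⟩ : ∃ w ∈ S.erase z, w ≠ x := by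
          by_contra! hall
          exact hS (eq_singleton_iff_unique_mem.2 ⟨mem_erase.2 ⟨hne, hx⟩, hall⟩)
        obtain ⟨hwz, hw⟩ := mem_erase.1 hw
        ext y
        have hy := huniv y
        have hx' := huniv x
        have hz' := huniv z
        have hw' := huniv w
        simp only [mem_insert, mem_singleton]
        grind
      subst hS'
      have hcases : z = a ∧ x = b ∨ z = a ∧ x = c ∨ z = b ∧ x = c := by
        have hx' := huniv x
        have hz' := huniv z
        grind
      rcases hcases with ⟨rfl, rfl⟩ | ⟨rfl, rfl⟩ | ⟨rfl, rfl⟩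
      · rw [ea, p2, p8]
        linarith
      · rw [ea, p3, p9]
        exact hlc.1
      · rw [eb, p3, p7]
        linarith
  · rw [eb, p1, p6]
    exact h2
  · rw [ec, p2, p5]
    linarith
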